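/- (Theorem 2, non-m-separability witness.) Let G = (V, E) be a finite simple graph with a proper k-coloring with color classes V_1, …, V_k, and let P_l = ∏_{i ∈ V_l} (S_i + I)/2. Let 2 ≤ m ≤ N. Then every m-separable density matrix ρ satisfies Σ_{l=1}^k Tr(P_l ρ) ≤ k − 1 + max_{𝒫_m} min_A 2^{−r(A)}, where the maximum is over all partitions 𝒫_m of V into m nonempty parts and the minimum is over all nonempty proper unions of parts A of 𝒫_m. -/

import Mathlib

open Matrix Finset
open scoped Classical ComplexOrder

noncomputable section

variable {V : Type} [Fintype V] [DecidableEq V]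

/-- The indicator function δ_i : V → ZMod 2 of a vertex `i`. -/
def delta (i : V) : V → ZMod 2 := fun v => if v = i then 1 else 0

/-- The stabilizer `S_i = X_i ⊗_{j ∈ N(i)} Z_j` of the graph `G` at vertex `i`,
as a matrix acting on the N-qubit Hilbert space `(V → ZMod 2) → ℂ`:
`(S_i ψ)(x) = (-1)^{∑_{j ∈ N(i)} x(j)} ψ(x + δ_i)`. -/
def stab (G : SimpleGraph V) (i : V) : Matrix (V → ZMod 2) (V → ZMod 2) ℂ :=
  Matrix.of fun x y =>
    if y = x + delta i then ((-1 : ℂ) ^ (∑ j ∈ univ.filter (fun j => G.Adj i j), (x j).val))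
    else 0

/-- The number of edges `{i,j}` of `G` with `x i = x j = 1`. -/
def edgeCount (G : SimpleGraph V) (x : V → ZMod 2) : ℕ :=
  (G.edgeFinset.filter (fun e => ∀ v ∈ e, x v = 1)).card

/-- The graph state of `G`: `g(x) = 2^{-N/2} (-1)^{e(x)}`. -/
def graphState (G : SimpleGraph V) : (V → ZMod 2) → ℂ :=
  fun x => ((-1 : ℂ) ^ edgeCount G x) / ((Real.sqrt 2 ^ Fintype.card V : ℝ) : ℂ)

/-- The stabilizer projector `∏_{i ∈ W} (S_i + I)/2` (the factors pairwise commute, so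
the order of multiplication is irrelevant; we use the canonical enumeration of `W`). -/
def stabProj (G : SimpleGraph V) (W : Finset V) : Matrix (V → ZMod 2) (V → ZMod 2) ℂ :=
  (W.toList.map (fun i => (2:ℂ)⁻¹ • (stab G i + 1))).prod

/-- The off-diagonal adjacency block `Γ_{A,Ā}` over `ZMod 2`. -/
def gammaMat (G : SimpleGraph V) (A : Finset V) :
    Matrix {v // v ∈ A} {v // v ∉ A} (ZMod 2) :=
  Matrix.of fun i j => if G.Adj i.1 j.1 then 1 else 0

/-- `r(A)`: the rank of `Γ_{A,Ā}` over `ZMod 2`. -/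
def gRank (G : SimpleGraph V) (A : Finset V) : ℕ := (gammaMat G A).rank

/-- Restriction of a computational-basis label to a subset `A`. -/
def restrictTo (A : Finset V) (x : V → ZMod 2) : {v // v ∈ A} → ZMod 2 := fun v => x v.1

/-- Restriction of a computational-basis label to the complement of `A`. -/
def restrictOut (A : Finset V) (x : V → ZMod 2) : {v // v ∉ A} → ZMod 2 := fun v => x v.1

/-- `ψ` is a product vector across the bipartition `{A, V \ A}`. -/
def IsProdVec (A : Finset V) (ψ : (V → ZMod 2) → ℂ) : Prop :=
  ∃ (φ : ({v // v ∈ A} → ZMod 2) → ℂ) (χ : ({v // v ∉ A} → ZMod 2) → ℂ),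
    ∀ x, ψ x = φ (restrictTo A x) * χ (restrictOut A x)

/-- `P : Fin m → Finset V` is a partition of `V` into `m` nonempty disjoint subsets. -/
def IsPartition {m : ℕ} (P : Fin m → Finset V) : Prop :=
  (∀ t, (P t).Nonempty) ∧ (∀ t t', t ≠ t' → Disjoint (P t) (P t')) ∧
    univ.biUnion P = univ

/-- `ψ` is a unit vector: `⟨ψ, ψ⟩ = 1`. -/
def IsUnit' (ψ : (V → ZMod 2) → ℂ) : Prop := star ψ ⬝ᵥ ψ = 1

/-- A pure state fully separable with respect to the partition `P`:
`ψ(x) = ∏_t φ_t(x|_{A_t})`. -/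
def FullSepPure {m : ℕ} (P : Fin m → Finset V) (ψ : (V → ZMod 2) → ℂ) : Prop :=
  ∃ φ : (t : Fin m) → ({v // v ∈ P t} → ZMod 2) → ℂ,
    ∀ x, ψ x = ∏ t, φ t (restrictTo (P t) x)

/-- A `P`-fully separable density matrix. -/
def FullSep {m : ℕ} (P : Fin m → Finset V) (ρ : Matrix (V → ZMod 2) (V → ZMod 2) ℂ) : Prop :=
  ∃ (M : ℕ) (p : Fin M → ℝ) (ψ : Fin M → ((V → ZMod 2) → ℂ)),
    (∀ i, 0 ≤ p i) ∧ (∑ i, p i) = 1 ∧ (∀ i, IsUnit' (ψ i)) ∧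
    (∀ i, FullSepPure P (ψ i)) ∧
    ρ = ∑ i, (p i : ℂ) • vecMulVec (ψ i) (star (ψ i))

/-- A `P`-bi-separable density matrix: a convex mixture of unit vectors each of which is a
product vector across `{A, V \ A}` for some nonempty proper union of parts `A` of `P`. -/
def BiSep {m : ℕ} (P : Fin m → Finset V) (ρ : Matrix (V → ZMod 2) (V → ZMod 2) ℂ) : Prop :=
  ∃ (M : ℕ) (p : Fin M → ℝ) (ψ : Fin M → ((V → ZMod 2) → ℂ)),
    (∀ i, 0 ≤ p i) ∧ (∑ i, p i) = 1 ∧ (∀ i, IsUnit' (ψ i)) ∧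
    (∀ i, ∃ S : Finset (Fin m), S.Nonempty ∧ S ≠ univ ∧ IsProdVec (S.biUnion P) (ψ i)) ∧
    ρ = ∑ i, (p i : ℂ) • vecMulVec (ψ i) (star (ψ i))

/-- An `m`-separable density matrix: a convex mixture of unit vectors each of which is
fully separable with respect to some partition of `V` into `m` nonempty parts. -/
def MSep (m : ℕ) (ρ : Matrix (V → ZMod 2) (V → ZMod 2) ℂ) : Prop :=
  ∃ (M : ℕ) (p : Fin M → ℝ) (ψ : Fin M → ((V → ZMod 2) → ℂ)),
    (∀ i, 0 ≤ p i) ∧ (∑ i, p i) = 1 ∧ (∀ i, IsUnit' (ψ i)) ∧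
    (∀ i, ∃ P : Fin m → Finset V, IsPartition P ∧ FullSepPure P (ψ i)) ∧
    ρ = ∑ i, (p i : ℂ) • vecMulVec (ψ i) (star (ψ i))

/-- A proper `k`-coloring of `G` with color classes `C 0, …, C (k-1)`:
the classes are disjoint, cover `V`, and each is an independent set. -/
def IsColoring (G : SimpleGraph V) {k : ℕ} (C : Fin k → Finset V) : Prop :=
  (∀ l l', l ≠ l' → Disjoint (C l) (C l')) ∧ univ.biUnion C = univ ∧
    ∀ l, ∀ i ∈ C l, ∀ j ∈ C l, ¬ G.Adj i j

/-- A density matrix: Hermitian positive semidefinite with trace 1. -/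
def IsDensity (ρ : Matrix (V → ZMod 2) (V → ZMod 2) ℂ) : Prop :=
  ρ.PosSemidef ∧ ρ.trace = 1

/-- Glue `a : A → ZMod 2` and `b : Ā → ZMod 2` into a function on `V`. -/
def glue (A : Finset V) (a : {v // v ∈ A} → ZMod 2) (b : {v // v ∉ A} → ZMod 2) :
    V → ZMod 2 := fun v => if h : v ∈ A then a ⟨v, h⟩ else b ⟨v, h⟩

/-- The reduced density matrix `ρ_A` of a pure state `ψ`. -/
def rdm (A : Finset V) (ψ : (V → ZMod 2) → ℂ) :
    Matrix ({v // v ∈ A} → ZMod 2) ({v // v ∈ A} → ZMod 2) ℂ :=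
  Matrix.of fun a a' => ∑ b : {v // v ∉ A} → ZMod 2,
    ψ (glue A a b) * (starRingEnd ℂ) (ψ (glue A a' b))


/-- The star graph on `Fin N` (center `0`, i.e. vertex labelled 1). -/
def starGraph (N : ℕ) : SimpleGraph (Fin N) :=
  SimpleGraph.fromRel (fun i _ => (i : ℕ) = 0)

/-- The path graph on `Fin N` (vertex `v` represents the label `v+1`). -/
def pathGraph (N : ℕ) : SimpleGraph (Fin N) :=
  SimpleGraph.fromRel (fun a b => (a : ℕ) + 1 = (b : ℕ))

/-- The `n × n` grid graph. -/
def gridGraph (n : ℕ) : SimpleGraph (Fin n × Fin n) :=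
  SimpleGraph.fromRel (fun a b => Nat.dist (a.1 : ℕ) (b.1 : ℕ) + Nat.dist (a.2 : ℕ) (b.2 : ℕ) = 1)

/-- The number of edges of `G` crossing the bipartition `{A, V \ A}` (each such edge is
counted once, as the ordered pair whose first component lies in `A`). -/
def crossCount {W : Type} [Fintype W] [DecidableEq W] (G : SimpleGraph W) (A : Finset W) : ℕ :=
  ((univ ×ˢ univ).filter fun p : W × W => G.Adj p.1 p.2 ∧ p.1 ∈ A ∧ p.2 ∉ A).card

/-- The nontrivial additive character `a ↦ (-1)^a` of `ZMod 2`. -/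
def sgn (a : ZMod 2) : ℂ := (-1) ^ a.val

lemma sgn_zero : sgn 0 = 1 := by simp [sgn]

lemma sgn_add (a b : ZMod 2) : sgn (a + b) = sgn a * sgn b := by
  rw [sgn, sgn, sgn, ← pow_add, ZMod.val_add, ← neg_one_pow_eq_pow_mod_two]

lemma sgn_mul_self (a : ZMod 2) : sgn a * sgn a = 1 := by
  rw [← sgn_add, CharTwo.add_self_eq_zero, sgn_zero]

lemma star_sgn (a : ZMod 2) : star (sgn a) = sgn a := by
  simp [sgn]

lemma norm_sgn (a : ZMod 2) : ‖sgn a‖ = 1 := by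
  simp [sgn]

lemma sgn_one : sgn 1 = -1 := by
  simp [sgn, ZMod.val_one]

lemma sgn_sum {ι : Type*} (s : Finset ι) (f : ι → ZMod 2) :
    sgn (∑ j ∈ s, f j) = (-1) ^ ∑ j ∈ s, (f j).val := by
  induction s using Finset.induction_on with
  | empty => simp [sgn_zero]
  | insert a s ha ih => rw [sum_insert ha, sum_insert ha, sgn_add, ih, pow_add, sgn]

/-- Orthogonality of characters of `(ZMod 2)^ι`. -/
lemma sum_sgn_dotProduct {ι : Type*} [Fintype ι] [DecidableEq ι] (x : ι → ZMod 2) :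
    ∑ z : ι → ZMod 2, sgn (x ⬝ᵥ z) = if x = 0 then 2 ^ Fintype.card ι else 0 := by
  split_ifs with h
  · subst h
    simp [sgn_zero, ZMod.card]
  · obtain ⟨i, hi⟩ := Function.ne_iff.mp h
    have hxi : x i = 1 := by
      have : ∀ a : ZMod 2, a ≠ 0 → a = 1 := by decide
      exact this _ hi
    have key : ∑ z : ι → ZMod 2, sgn (x ⬝ᵥ z) = -∑ z : ι → ZMod 2, sgn (x ⬝ᵥ z) := by
      conv_lhs => rw [← Equiv.sum_comp (Equiv.addRight (Pi.single i (1 : ZMod 2)))]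
      rw [← sum_neg_distrib]
      refine sum_congr rfl fun z _ => ?_
      simp [dotProduct_add, sgn_add, hxi, sgn_one]
    linear_combination key / 2

lemma sgn_dotProduct_mul_sgn_dotProduct {ι : Type*} [Fintype ι] (x y z : ι → ZMod 2) :
    sgn (x ⬝ᵥ z) * sgn (y ⬝ᵥ z) = sgn ((x + y) ⬝ᵥ z) := by
  rw [add_dotProduct, sgn_add]

/-- The Hadamard transform with its rows multiplied by signs `(-1)^(q x)`. -/
def signedHadamard {ι : Type*} [Fintype ι] (q : (ι → ZMod 2) → ZMod 2) :
    Matrix (ι → ZMod 2) (ι → ZMod 2) ℂ :=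
  Matrix.of fun x z => sgn (q x) * sgn (x ⬝ᵥ z)

lemma signedHadamard_mul_conjTranspose {ι : Type*} [Fintype ι] [DecidableEq ι]
    (q : (ι → ZMod 2) → ZMod 2) :
    signedHadamard q * (signedHadamard q)ᴴ = (2 : ℂ) ^ Fintype.card ι • 1 := by
  ext x y
  have h : (signedHadamard q * (signedHadamard q)ᴴ) x y =
      sgn (q x) * sgn (q y) * ∑ z, sgn ((x + y) ⬝ᵥ z) := by
    simp only [Matrix.mul_apply, conjTranspose_apply, signedHadamard, of_apply, star_mul',
      star_sgn, mul_sum, ← sgn_dotProduct_mul_sgn_dotProduct]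
    exact sum_congr rfl fun z _ => by ring
  have hxy : x + y = 0 ↔ x = y := by
    rw [add_eq_zero_iff_eq_neg, show -y = y from funext fun i => CharTwo.neg_eq (y i)]
  rw [h, sum_sgn_dotProduct]
  by_cases e : x = y
  · subst e
    simp [hxy.mpr rfl, sgn_mul_self]
  · simp [hxy, e]

lemma star_dotProduct_self {ι : Type*} [Fintype ι] (v : ι → ℂ) :
    star v ⬝ᵥ v = ((∑ x, ‖v x‖ ^ 2 : ℝ) : ℂ) := by
  simp [dotProduct, Complex.conj_mul']

/-- Parseval's identity for the signed Hadamard transform. -/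
lemma sum_norm_sq_conjTranspose_signedHadamard_mulVec {ι : Type*} [Fintype ι] [DecidableEq ι]
    (q : (ι → ZMod 2) → ZMod 2) (v : (ι → ZMod 2) → ℂ) :
    ∑ z, ‖((signedHadamard q)ᴴ *ᵥ v) z‖ ^ 2 = 2 ^ Fintype.card ι * ∑ x, ‖v x‖ ^ 2 := by
  have h := star_dotProduct_self ((signedHadamard q)ᴴ *ᵥ v)
  rw [star_mulVec, conjTranspose_conjTranspose, ← dotProduct_mulVec, mulVec_mulVec,
    signedHadamard_mul_conjTranspose, smul_mulVec, one_mulVec, dotProduct_smul,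
    star_dotProduct_self] at h
  rw [← Complex.ofReal_inj, ← h]
  simp

/-- A bilinear form orienting the edges of `G`. -/
lemma exists_orientation (G : SimpleGraph V) : ∃ B : Matrix V V (ZMod 2),
    (∀ i, B i i = 0) ∧ ∀ i j, B i j + B j i = if G.Adj i j then 1 else 0 := by
  refine ⟨Matrix.of fun i j =>
    if G.Adj i j ∧ Fintype.equivFin V i < Fintype.equivFin V j then 1 else 0, by simp, ?_⟩
  intro i j
  by_cases h : G.Adj i j
  · have hne : Fintype.equivFin V i ≠ Fintype.equivFin V j := by simpa using h.ne
    rcases lt_or_gt_of_ne hne with hl | hl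
    · simp [h, h.symm, hl, hl.not_gt]
    · simp [h, h.symm, hl, hl.not_gt]
  · have h' : ¬ G.Adj j i := fun e => h e.symm
    simp [h, h']

/-- The adjacency pairing `x · Γ y` of a graph. -/
def adjPairing (G : SimpleGraph V) (x y : V → ZMod 2) : ZMod 2 :=
  ∑ i, x i * ∑ j, (if G.Adj i j then 1 else 0) * y j

/-- `q` is the quadratic form of `G`, so that `x ↦ (-1)^(q x)` is the graph state up to
normalization. -/
structure IsGraphForm (G : SimpleGraph V) (q : (V → ZMod 2) → ZMod 2) : Prop where
  map_add : ∀ x y, q (x + y) = q x + q y + adjPairing G x y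
  map_single : ∀ i, q (Pi.single i 1) = 0

lemma exists_isGraphForm (G : SimpleGraph V) : ∃ q, IsGraphForm G q := by
  obtain ⟨B, hB0, hB⟩ := exists_orientation G
  refine ⟨fun x => x ⬝ᵥ B *ᵥ x, fun x y => ?_, fun i => by simp [hB0]⟩
  have h : adjPairing G x y = x ⬝ᵥ B *ᵥ y + y ⬝ᵥ B *ᵥ x := by
    rw [dotProduct_mulVec y, ← mulVec_transpose, dotProduct_comm _ x, ← dotProduct_add,
      ← add_mulVec]
    simp only [adjPairing, ← hB, dotProduct, mulVec, Matrix.add_apply, Matrix.transpose_apply]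
  rw [h]
  simp only [mulVec_add, add_dotProduct, dotProduct_add]
  ring

lemma delta_eq_single (i : V) : delta i = Pi.single i 1 := by
  ext v
  simp [delta, Pi.single_apply]

lemma adjPairing_single (G : SimpleGraph V) (x : V → ZMod 2) (i : V) :
    adjPairing G x (Pi.single i 1) = ∑ j ∈ univ.filter (fun j => G.Adj i j), x j := by
  simp [adjPairing, Pi.single_apply, sum_filter, G.adj_comm i]

lemma stab_mul_signedHadamard (G : SimpleGraph V) {q : (V → ZMod 2) → ZMod 2}
    (hq : IsGraphForm G q) (i : V) :
    stab G i * signedHadamard q = signedHadamard q * diagonal fun z => sgn (z i) := by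
  ext x z
  rw [mul_diagonal, Matrix.mul_apply]
  simp only [stab, of_apply, ite_mul, zero_mul, sum_ite_eq', mem_univ, if_true, signedHadamard]
  rw [← sgn_sum, ← adjPairing_single, delta_eq_single, hq.map_add, hq.map_single, add_zero,
    sgn_add, add_dotProduct, sgn_add, single_one_dotProduct]
  linear_combination (sgn (q x) * sgn (x ⬝ᵥ z) * sgn (z i)) *
    sgn_mul_self (adjPairing G x (Pi.single i 1))

lemma listProd_mul_signedHadamard (G : SimpleGraph V) {q : (V → ZMod 2) → ZMod 2}
    (hq : IsGraphForm G q) (L : List V) :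
    (L.map (fun i => (2:ℂ)⁻¹ • (stab G i + 1))).prod * signedHadamard q =
      signedHadamard q * diagonal fun z => if ∀ i ∈ L, z i = 0 then 1 else 0 := by
  induction L with
  | nil => simp
  | cons i L ih =>
    have h1 : ((2:ℂ)⁻¹ • (stab G i + 1)) * signedHadamard q =
        signedHadamard q * diagonal fun z => if z i = 0 then 1 else 0 := by
      rw [smul_mul_assoc, add_mul, stab_mul_signedHadamard G hq, one_mul]
      ext x z
      have hz : ∀ a : ZMod 2, (2:ℂ)⁻¹ * (sgn a + 1) = if a = 0 then 1 else 0 := by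
        intro a
        have : a = 0 ∨ a = 1 := by revert a; decide
        rcases this with rfl | rfl
        · norm_num [sgn_zero]
        · simp [sgn_one]
      simp only [Matrix.smul_apply, Matrix.add_apply, mul_diagonal, smul_eq_mul]
      rw [← hz]
      ring
    rw [List.map_cons, List.prod_cons, mul_assoc, ih, ← mul_assoc, h1, mul_assoc,
      diagonal_mul_diagonal]
    congr 2
    ext z
    by_cases hi : z i = 0 <;> simp [hi]

lemma trace_stabProj_mul (G : SimpleGraph V) {q : (V → ZMod 2) → ZMod 2}
    (hq : IsGraphForm G q) (W : Finset V) (v : (V → ZMod 2) → ℂ) :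
    (2 : ℂ) ^ Fintype.card V * (stabProj G W * vecMulVec v (star v)).trace =
      ((∑ z, if ∀ i ∈ W, z i = 0 then ‖((signedHadamard q)ᴴ *ᵥ v) z‖ ^ 2 else 0 : ℝ) : ℂ) := by
  have h : (2 : ℂ) ^ Fintype.card V • stabProj G W =
      signedHadamard q * (diagonal fun z => if ∀ i ∈ W, z i = 0 then 1 else 0) *
        (signedHadamard q)ᴴ := by
    have h2 := listProd_mul_signedHadamard G hq W.toList
    simp only [mem_toList] at h2
    rw [← h2, mul_assoc, signedHadamard_mul_conjTranspose, mul_smul_comm, mul_one]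
    rfl
  rw [mul_vecMulVec, trace_vecMulVec, ← smul_eq_mul, ← smul_dotProduct, ← smul_mulVec, h,
    dotProduct_comm, ← mulVec_mulVec, ← mulVec_mulVec, dotProduct_mulVec]
  have h3 : star v ᵥ* signedHadamard q = star ((signedHadamard q)ᴴ *ᵥ v) := by
    rw [star_mulVec, conjTranspose_conjTranspose]
  rw [h3]
  push_cast
  simp only [dotProduct, mulVec_diagonal]
  refine sum_congr rfl fun z _ => ?_
  split_ifs
  · simp [Complex.conj_mul']
  · simp

lemma glue_eq_add (A : Finset V) (a : {v // v ∈ A} → ZMod 2) (b : {v // v ∉ A} → ZMod 2) :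
    glue A a b = glue A a 0 + glue A 0 b := by
  ext v
  by_cases h : v ∈ A <;> simp [glue, h]

lemma glue_restrict (A : Finset V) (x : V → ZMod 2) :
    glue A (restrictTo A x) (restrictOut A x) = x := by
  ext v
  by_cases h : v ∈ A <;> simp [glue, restrictTo, restrictOut, h]

lemma restrictTo_glue (A : Finset V) (a : {v // v ∈ A} → ZMod 2)
    (b : {v // v ∉ A} → ZMod 2) : restrictTo A (glue A a b) = a := by
  ext v
  simp [glue, restrictTo]

lemma restrictOut_glue (A : Finset V) (a : {v // v ∈ A} → ZMod 2)
    (b : {v // v ∉ A} → ZMod 2) : restrictOut A (glue A a b) = b := by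
  ext v
  simp [glue, restrictOut, v.2]

lemma sum_eq_sum_glue {M : Type*} [AddCommMonoid M] (A : Finset V) (f : (V → ZMod 2) → M) :
    ∑ x, f x = ∑ b, ∑ a, f (glue A a b) := by
  rw [sum_comm, ← Fintype.sum_prod_type']
  refine (Fintype.sum_equiv ⟨fun p : (_ → _) × (_ → _) => glue A p.1 p.2,
    fun x => (restrictTo A x, restrictOut A x), fun p => ?_, fun x => glue_restrict A x⟩ _ _ ?_).symm
  · simp [restrictTo_glue, restrictOut_glue]
  · exact fun p => rfl

lemma adjPairing_glue (G : SimpleGraph V) (A : Finset V) (a : {v // v ∈ A} → ZMod 2)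
    (b : {v // v ∉ A} → ZMod 2) :
    adjPairing G (glue A a 0) (glue A 0 b) = a ⬝ᵥ gammaMat G A *ᵥ b := by
  have hl (f : V → ZMod 2) : ∑ i, glue A a 0 i * f i = ∑ i : {v // v ∈ A}, a i * f i := by
    rw [← Fintype.sum_subtype_add_sum_subtype (fun v => v ∈ A)]
    refine (congrArg₂ (· + ·) (sum_congr (Finset.ext fun _ => by simp) fun i _ => ?_)
      (sum_eq_zero fun i _ => ?_)).trans (add_zero _)
    · simp [glue]
    · simp [glue, i.2]
  have hr (f : V → ZMod 2) : ∑ i, f i * glue A 0 b i = ∑ i : {v // v ∉ A}, f i * b i := by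
    rw [← Fintype.sum_subtype_add_sum_subtype (fun v => v ∈ A)]
    refine (congrArg₂ (· + ·) (sum_eq_zero fun i _ => ?_)
      (sum_congr (Finset.ext fun _ => by simp) fun i _ => ?_)).trans (zero_add _)
    · simp [glue]
    · simp [glue, i.2]
  simp only [adjPairing, hl, hr]
  rfl

/-- Over `ZMod 2`, the fibres of `Γ` have at most `2^(n - rank Γ)` elements. -/
lemma card_fiber_mulVec_le {ι κ : Type*} [Fintype ι] [Fintype κ] [DecidableEq κ]
    (Γ : Matrix ι κ (ZMod 2)) (y : ι → ZMod 2) :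
    2 ^ Γ.rank * (univ.filter fun b : κ → ZMod 2 => Γ *ᵥ b = y).card ≤ 2 ^ Fintype.card κ := by
  have hle : (univ.filter fun b : κ → ZMod 2 => Γ *ᵥ b = y).card ≤
      Nat.card (LinearMap.ker Γ.mulVecLin) := by
    rcases (univ.filter fun b : κ → ZMod 2 => Γ *ᵥ b = y).eq_empty_or_nonempty with h | ⟨c, hc⟩
    · rw [h, card_empty]
      exact Nat.zero_le _
    · rw [← Nat.card_eq_finsetCard]
      refine Nat.card_le_card_of_injective (fun b => ⟨b.1 - c, ?_⟩) fun b b' hb => ?_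
      · rw [LinearMap.mem_ker, mulVecLin_apply, mulVec_sub, (mem_filter.mp b.2).2,
          (mem_filter.mp hc).2, sub_self]
      · exact Subtype.ext (sub_left_injective (congrArg Subtype.val hb))
  have hcard : Nat.card (LinearMap.ker Γ.mulVecLin) =
      2 ^ Module.finrank (ZMod 2) (LinearMap.ker Γ.mulVecLin) := by
    rw [Module.natCard_eq_pow_finrank (K := ZMod 2), Nat.card_zmod]
  have hrn := LinearMap.finrank_range_add_finrank_ker Γ.mulVecLin
  rw [Module.finrank_fintype_fun_eq_card] at hrn
  rw [← hrn, pow_add, ← hcard]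
  exact Nat.mul_le_mul_left _ hle

/-- The sum of a nonnegative function along `Γ`. -/
lemma sum_comp_mulVec_le {ι κ : Type*} [Fintype ι] [DecidableEq ι] [Fintype κ] [DecidableEq κ]
    (Γ : Matrix ι κ (ZMod 2)) (F : (ι → ZMod 2) → ℝ) (hF : ∀ y, 0 ≤ F y) :
    2 ^ Γ.rank * ∑ b, F (Γ *ᵥ b) ≤ 2 ^ Fintype.card κ * ∑ y, F y := by
  rw [← sum_fiberwise univ (fun b => Γ *ᵥ b), mul_sum, mul_sum]
  refine sum_le_sum fun y _ => ?_
  rw [sum_congr rfl (g := fun _ => F y) fun b hb => by rw [(mem_filter.mp hb).2], sum_const,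
    nsmul_eq_mul, ← mul_assoc]
  refine mul_le_mul_of_nonneg_right ?_ (hF y)
  exact_mod_cast card_fiber_mulVec_le Γ y

/-- The fidelity of a product vector with the graph state is at most `2^(-r(A))`. -/
lemma norm_sq_overlap_le (G : SimpleGraph V) {q : (V → ZMod 2) → ZMod 2}
    (hq : IsGraphForm G q) (A : Finset V) {ψ : (V → ZMod 2) → ℂ} (hψ : IsProdVec A ψ) :
    2 ^ gRank G A * ‖∑ x, sgn (q x) * ψ x‖ ^ 2 ≤
      2 ^ Fintype.card V * ∑ x, ‖ψ x‖ ^ 2 := by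
  obtain ⟨φ, χ, h⟩ := hψ
  set H := (signedHadamard fun a => q (glue A a 0))ᴴ *ᵥ φ with hH
  have hov : ∑ x, sgn (q x) * ψ x =
      ∑ b, sgn (q (glue A 0 b)) * χ b * H (gammaMat G A *ᵥ b) := by
    have hHy (y) : H y = ∑ a, sgn (q (glue A a 0)) * sgn (a ⬝ᵥ y) * φ a := by
      rw [hH, mulVec, dotProduct]
      simp only [conjTranspose_apply, signedHadamard, of_apply, star_mul', star_sgn]
    rw [sum_eq_sum_glue A]
    refine sum_congr rfl fun b _ => ?_
    rw [hHy, mul_sum]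
    refine sum_congr rfl fun a _ => ?_
    rw [h, restrictTo_glue, restrictOut_glue, glue_eq_add, hq.map_add, adjPairing_glue, sgn_add,
      sgn_add]
    ring
  have hnorm : ∑ x, ‖ψ x‖ ^ 2 = (∑ b, ‖χ b‖ ^ 2) * ∑ a, ‖φ a‖ ^ 2 := by
    rw [sum_eq_sum_glue A, sum_mul_sum]
    refine sum_congr rfl fun b _ => sum_congr rfl fun a _ => ?_
    rw [h, restrictTo_glue, restrictOut_glue, norm_mul]
    ring
  have hcs : ‖∑ x, sgn (q x) * ψ x‖ ^ 2 ≤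
      (∑ b, ‖χ b‖ ^ 2) * ∑ b, ‖H (gammaMat G A *ᵥ b)‖ ^ 2 := by
    refine le_trans ?_ (sum_mul_sq_le_sq_mul_sq _ _ _)
    rw [hov]
    gcongr
    refine (norm_sum_le _ _).trans_eq ?_
    simp [norm_sgn]
  have hfib := sum_comp_mulVec_le (gammaMat G A) (fun y => ‖H y‖ ^ 2) fun y => by positivity
  rw [hH, sum_norm_sq_conjTranspose_signedHadamard_mulVec, ← hH] at hfib
  have hcard : Fintype.card V = Fintype.card {v // v ∉ A} + Fintype.card {v // v ∈ A} := by
    rw [add_comm, ← Fintype.card_sum]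
    exact Fintype.card_congr (Equiv.sumCompl (fun v => v ∈ A)).symm
  calc 2 ^ gRank G A * ‖∑ x, sgn (q x) * ψ x‖ ^ 2
      ≤ 2 ^ gRank G A * ((∑ b, ‖χ b‖ ^ 2) * ∑ b, ‖H (gammaMat G A *ᵥ b)‖ ^ 2) := by gcongr
    _ = (∑ b, ‖χ b‖ ^ 2) * (2 ^ (gammaMat G A).rank * ∑ b, ‖H (gammaMat G A *ᵥ b)‖ ^ 2) := by
        rw [gRank]; ring
    _ ≤ (∑ b, ‖χ b‖ ^ 2) * (2 ^ Fintype.card {v // v ∉ A} *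
          (2 ^ Fintype.card {v // v ∈ A} * ∑ a, ‖φ a‖ ^ 2)) := by gcongr
    _ = _ := by rw [hnorm, hcard, pow_add]; ring

/-- A fully separable vector is a product vector across any union of parts. -/
lemma FullSepPure.isProdVec {m : ℕ} {P : Fin m → Finset V} (hP : IsPartition P)
    {ψ : (V → ZMod 2) → ℂ} (hψ : FullSepPure P ψ) (S : Finset (Fin m)) :
    IsProdVec (S.biUnion P) ψ := by
  obtain ⟨φ, h⟩ := hψ
  refine ⟨fun a => ∏ t ∈ S, φ t (restrictTo (P t) (glue (S.biUnion P) a 0)),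
    fun b => ∏ t ∈ Sᶜ, φ t (restrictTo (P t) (glue (S.biUnion P) 0 b)), fun x => ?_⟩
  rw [h, ← prod_mul_prod_compl S]
  congr 1
  · refine prod_congr rfl fun t ht => congrArg _ ?_
    ext v
    have hv : v.1 ∈ S.biUnion P := mem_biUnion.mpr ⟨t, ht, v.2⟩
    simp only [restrictTo, glue, dif_pos hv]
  · refine prod_congr rfl fun t ht => congrArg _ ?_
    ext v
    have hv : v.1 ∉ S.biUnion P := fun hv => by
      obtain ⟨s, hs, hvs⟩ := mem_biUnion.mp hv
      have hne : s ≠ t := fun e => mem_compl.mp ht (e ▸ hs)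
      exact disjoint_left.mp (hP.2.1 s t hne) hvs v.2
    simp only [restrictTo, restrictOut, glue, dif_neg hv]

/-- The max-min value of `2^(-r(A))` bounding `m`-separable fidelities. -/
def maxMinWeight (G : SimpleGraph V) (m : ℕ) : ℝ :=
  ⨆ P : {P : Fin m → Finset V // IsPartition P},
    ⨅ S : {S : Finset (Fin m) // S.Nonempty ∧ S ≠ univ},
      ((2 : ℝ) ^ gRank G (S.1.biUnion P.1))⁻¹

lemma norm_sq_overlap_le_maxMinWeight (G : SimpleGraph V) {q : (V → ZMod 2) → ZMod 2}
    (hq : IsGraphForm G q) {m : ℕ} (hm : 2 ≤ m) {P : Fin m → Finset V} (hP : IsPartition P)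
    {ψ : (V → ZMod 2) → ℂ} (hψ : FullSepPure P ψ) (hu : ∑ x, ‖ψ x‖ ^ 2 = 1) :
    ‖∑ x, sgn (q x) * ψ x‖ ^ 2 ≤ 2 ^ Fintype.card V * maxMinWeight G m := by
  have : Nontrivial (Fin m) := Fin.nontrivial_iff_two_le.mpr hm
  have : Nonempty {S : Finset (Fin m) // S.Nonempty ∧ S ≠ univ} :=
    ⟨⟨{⟨0, by omega⟩}, singleton_nonempty _, singleton_ne_univ _⟩⟩
  rw [← div_le_iff₀' (by positivity), maxMinWeight]
  refine le_ciSup_of_le (Set.finite_range _).bddAbove ⟨P, hP⟩ (le_ciInf fun S => ?_)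
  have h := norm_sq_overlap_le G hq (S.1.biUnion P) (hψ.isProdVec hP S.1)
  rw [hu, mul_one] at h
  rw [← one_div, div_le_div_iff₀ (by positivity) (by positivity)]
  linarith

/-- At most `k - 1` color classes avoid the support of a nonzero `z`. -/
lemma card_vanishing_le (G : SimpleGraph V) {k : ℕ} {C : Fin k → Finset V}
    (hC : IsColoring G C) (z : V → ZMod 2) :
    (∑ l, if ∀ i ∈ C l, z i = 0 then (1 : ℝ) else 0) ≤ k - 1 + if z = 0 then 1 else 0 := by
  rw [sum_boole]
  split_ifs with hz
  · have := card_le_univ (univ.filter fun l => ∀ i ∈ C l, z i = 0)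
    rw [Fintype.card_fin] at this
    have : ((univ.filter fun l => ∀ i ∈ C l, z i = 0).card : ℝ) ≤ k := by exact_mod_cast this
    linarith
  · obtain ⟨i, hi⟩ := Function.ne_iff.mp hz
    obtain ⟨l, -, hl⟩ := mem_biUnion.mp (hC.2.1 ▸ mem_univ i)
    have hlt : (univ.filter fun l => ∀ i ∈ C l, z i = 0).card < k := by
      conv_rhs => rw [← Fintype.card_fin k]
      exact card_lt_univ_of_notMem (x := l) fun h => hi ((mem_filter.mp h).2 i hl)
    have : ((univ.filter fun l => ∀ i ∈ C l, z i = 0).card : ℝ) + 1 ≤ k := by exact_mod_cast hlt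
    linarith

lemma sum_trace_stabProj_pure_le (G : SimpleGraph V) {k : ℕ} {C : Fin k → Finset V}
    (hC : IsColoring G C) {m : ℕ} (hm : 2 ≤ m) {P : Fin m → Finset V} (hP : IsPartition P)
    {ψ : (V → ZMod 2) → ℂ} (hψ : FullSepPure P ψ) (hu : IsUnit' ψ) :
    ∑ l, (stabProj G (C l) * vecMulVec ψ (star ψ)).trace ≤
      ((k - 1 + maxMinWeight G m : ℝ) : ℂ) := by
  obtain ⟨q, hq⟩ := exists_isGraphForm G
  have hu' : ∑ x, ‖ψ x‖ ^ 2 = 1 := by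
    rw [IsUnit', star_dotProduct_self] at hu
    exact_mod_cast hu
  set w := (signedHadamard q)ᴴ *ᵥ ψ with hw
  have hpos : (0 : ℝ) < 2 ^ Fintype.card V := by positivity
  have hsum : ∑ l, (stabProj G (C l) * vecMulVec ψ (star ψ)).trace =
      (((2 ^ Fintype.card V)⁻¹ *
        ∑ z, (∑ l, if ∀ i ∈ C l, z i = 0 then (1 : ℝ) else 0) * ‖w z‖ ^ 2 : ℝ) : ℂ) := by
    have h1 : (2 ^ Fintype.card V : ℂ) ≠ 0 := by positivity
    rw [Complex.ofReal_mul, Complex.ofReal_inv, Complex.ofReal_pow, Complex.ofReal_ofNat,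
      eq_inv_mul_iff_mul_eq₀ h1, mul_sum]
    simp only [trace_stabProj_mul G hq, sum_mul, ite_mul, one_mul, zero_mul]
    rw [← Complex.ofReal_sum, sum_comm]
  have hw0 : w 0 = ∑ x, sgn (q x) * ψ x := by
    simp [hw, mulVec, dotProduct, signedHadamard, star_sgn, sgn_zero]
  have hpars : ∑ z, ‖w z‖ ^ 2 = 2 ^ Fintype.card V := by
    rw [hw, sum_norm_sq_conjTranspose_signedHadamard_mulVec, hu', mul_one]
  have hfid := norm_sq_overlap_le_maxMinWeight G hq hm hP hψ hu'
  rw [← hw0] at hfid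
  rw [hsum, Complex.real_le_real, inv_mul_le_iff₀ hpos]
  calc ∑ z, (∑ l, if ∀ i ∈ C l, z i = 0 then (1 : ℝ) else 0) * ‖w z‖ ^ 2
      ≤ ∑ z, ((k : ℝ) - 1 + if z = 0 then 1 else 0) * ‖w z‖ ^ 2 :=
        sum_le_sum fun z _ =>
          mul_le_mul_of_nonneg_right (card_vanishing_le G hC z) (by positivity)
    _ = ((k : ℝ) - 1) * 2 ^ Fintype.card V + ‖w 0‖ ^ 2 := by
        simp [add_mul, sum_add_distrib, ← mul_sum, hpars]
    _ ≤ _ := by linarith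

/-- Theorem 2, non-m-separability witness: for a proper `k`-coloring `C` of `G` with
projectors `P_l = ∏_{i ∈ C l} (S_i + I)/2`, and `2 ≤ m ≤ N`, every `m`-separable density
matrix `ρ` satisfies `∑_l Tr(P_l ρ) ≤ k - 1 + max_{P_m} min_A 2^{-r(A)}`, where the
maximum ranges over partitions of `V` into `m` nonempty parts and the minimum over
nonempty proper unions of parts of the partition. -/
theorem witness_mSep (G : SimpleGraph V) {k : ℕ} (C : Fin k → Finset V)
    (hC : IsColoring G C) (m : ℕ) (hm : 2 ≤ m) (hmN : m ≤ Fintype.card V)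
    (ρ : Matrix (V → ZMod 2) (V → ZMod 2) ℂ) (hρd : IsDensity ρ) (hρ : MSep m ρ) :
    ∑ l, (stabProj G (C l) * ρ).trace ≤
      (((k : ℝ) - 1 + ⨆ P : {P : Fin m → Finset V // IsPartition P},
        ⨅ S : {S : Finset (Fin m) // S.Nonempty ∧ S ≠ univ},
          ((2 : ℝ) ^ gRank G (S.1.biUnion P.1))⁻¹ : ℝ) : ℂ) := by
  obtain ⟨M, p, ψ, hp, hsum, hu, hsep, rfl⟩ := hρ
  have hlin : ∑ l, (stabProj G (C l) *
        ∑ i, (p i : ℂ) • vecMulVec (ψ i) (star (ψ i))).trace =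
      ∑ i, (p i : ℂ) * ∑ l, (stabProj G (C l) * vecMulVec (ψ i) (star (ψ i))).trace := by
    simp only [Matrix.mul_sum, mul_smul_comm, trace_sum, trace_smul, smul_eq_mul]
    rw [sum_comm]
    simp only [mul_sum]
  have hbound : ∑ i, (p i : ℂ) * ∑ l, (stabProj G (C l) * vecMulVec (ψ i) (star (ψ i))).trace ≤
      ∑ i, (p i : ℂ) * ((k - 1 + maxMinWeight G m : ℝ) : ℂ) := by
    refine sum_le_sum fun i _ => ?_
    obtain ⟨P, hP, hψ⟩ := hsep i
    exact mul_le_mul_of_nonneg_left (sum_trace_stabProj_pure_le G hC hm hP hψ (hu i))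
      (Complex.zero_le_real.mpr (hp i))
  rw [hlin]
  refine hbound.trans_eq ?_
  rw [← sum_mul, ← Complex.ofReal_sum, hsum, Complex.ofReal_one, one_mul]
  rfl
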